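/- Let d, q ≥ 1, h > 0, c ∈ ℝ^d, let B : ℝ^d → ℝ^d be affine, and let φ : ℝ^d → ℝ be convex with linear growth. Then for every fixed x ∈ ℝ^d, the function u ∈ M_{d,q}(ℝ) ↦ ∫_{ℝ^q} φ(x + h·B(x) + √h·u z + c) γ_q(dz) is non-decreasing with respect to the matrix partial order ⪯: if u, v ∈ M_{d,q}(ℝ) satisfy u ⪯ v (i.e. vvᵀ − uuᵀ is positive semidefinite), then ∫_{ℝ^q} φ(x + h·B(x) + √h·u z + c) γ_q(dz) ≤ ∫_{ℝ^q} φ(x + h·B(x) + √h·v z + c) γ_q(dz). -/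

import Mathlib

open MeasureTheory ProbabilityTheory

noncomputable section

/-- The standard Gaussian measure on `ℝ^q` (the law of `q` i.i.d. standard normals). -/
def stdGaussian (q : ℕ) : Measure (EuclideanSpace ℝ (Fin q)) :=
  (Measure.pi fun _ : Fin q => gaussianReal 0 1).map (EuclideanSpace.equiv (Fin q) ℝ).symm

/-- Matrix-vector product `u z` viewed between Euclidean spaces. -/
def matVec {d q : ℕ} (u : Matrix (Fin d) (Fin q) ℝ) (z : EuclideanSpace ℝ (Fin q)) :
    EuclideanSpace ℝ (Fin d) :=
  (EuclideanSpace.equiv (Fin d) ℝ).symm (u.mulVec (EuclideanSpace.equiv (Fin q) ℝ z))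

/-- The matrix partial order: `A ⪯ B` iff `B Bᵀ - A Aᵀ` is positive semidefinite. -/
def matLE {d q : ℕ} (A B : Matrix (Fin d) (Fin q) ℝ) : Prop :=
  (B * B.transpose - A * A.transpose).PosSemidef

lemma stdGaussian_eq_probabilityTheory_stdGaussian (q : ℕ) :
    _root_.stdGaussian q = ProbabilityTheory.stdGaussian (EuclideanSpace ℝ (Fin q)) :=
  map_pi_eq_stdGaussian

lemma matVec_eq_toEuclideanLin {d q : ℕ} (u : Matrix (Fin d) (Fin q) ℝ) :
    matVec u = (Matrix.toEuclideanLin u).toContinuousLinearMap :=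
  rfl

instance isGaussian_map_matVec {d q : ℕ} (u : Matrix (Fin d) (Fin q) ℝ) :
    IsGaussian ((_root_.stdGaussian q).map (matVec u)) := by
  rw [stdGaussian_eq_probabilityTheory_stdGaussian, matVec_eq_toEuclideanLin]
  infer_instance

open scoped Matrix in
/-- The law of `u z` under the standard Gaussian measure is `N(0, u uᵀ)`. -/
lemma map_matVec_eq_multivariateGaussian {d q : ℕ} (u : Matrix (Fin d) (Fin q) ℝ) :
    (_root_.stdGaussian q).map (matVec u) = multivariateGaussian 0 (u * u.transpose) := by
  have hS : (u * u.transpose).PosSemidef := by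
    simpa using Matrix.posSemidef_self_mul_conjTranspose u
  apply Measure.ext_of_charFun
  ext t
  have hnorm : ‖(Matrix.toEuclideanLin u).toContinuousLinearMap.adjoint t‖ ^ 2 =
      t ⬝ᵥ (u * u.transpose) *ᵥ t := by
    have hadj : (Matrix.toEuclideanLin u).toContinuousLinearMap.adjoint t =
        Matrix.toEuclideanLin u.transpose t := by
      refine ext_inner_right ℝ fun y => ?_
      rw [ContinuousLinearMap.adjoint_inner_left, LinearMap.coe_toContinuousLinearMap',
        ← Matrix.conjTranspose_eq_transpose_of_trivial,
        Matrix.toEuclideanLin_conjTranspose_eq_adjoint, LinearMap.adjoint_inner_left]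
    rw [hadj, EuclideanSpace.real_norm_sq_eq, ← Matrix.mulVec_mulVec, Matrix.dotProduct_mulVec,
      ← Matrix.mulVec_transpose]
    simp [dotProduct, sq]
  rw [charFun_multivariateGaussian hS, stdGaussian_eq_probabilityTheory_stdGaussian,
    matVec_eq_toEuclideanLin, charFun_apply,
    integral_map (by fun_prop) (by fun_prop)]
  simp_rw [← ContinuousLinearMap.adjoint_inner_right]
  rw [← charFun_apply, charFun_stdGaussian, ← hnorm]
  simp [neg_div]

/-- Covariances of centred Gaussian vectors add up under independent sums. -/
lemma map_add_prod_multivariateGaussian {ι : Type*} [Fintype ι] [DecidableEq ι]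
    {S T : Matrix ι ι ℝ} (hS : S.PosSemidef) (hT : T.PosSemidef) :
    ((multivariateGaussian 0 S).prod (multivariateGaussian 0 T)).map (fun p => p.1 + p.2) =
      multivariateGaussian 0 (S + T) := by
  apply Measure.ext_of_charFun
  ext t
  rw [charFun_map_add_prod_eq_mul, Pi.mul_apply, charFun_multivariateGaussian hS,
    charFun_multivariateGaussian hT, charFun_multivariateGaussian (hS.add hT),
    ← Complex.exp_add, Matrix.add_mulVec, dotProduct_add]
  congr 1
  simp only [inner_zero_right]
  push_cast
  ring

section

variable {E : Type*} [NormedAddCommGroup E] [MeasurableSpace E] [BorelSpace E]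

lemma integrable_of_linear_growth [SecondCountableTopology E] {μ : Measure E} [IsFiniteMeasure μ]
    (hμ : Integrable (fun x => x) μ) {f : E → ℝ} (hf : Continuous f) {C : ℝ}
    (hC : ∀ x, |f x| ≤ C * (1 + ‖x‖)) : Integrable f μ :=
  (((integrable_const (1 : ℝ)).add hμ.norm).const_mul C).mono' hf.aestronglyMeasurable
    (.of_forall hC)

variable [NormedSpace ℝ E] [FiniteDimensional ℝ E]

/-- Adding independent centred noise increases the integrals of convex functions. -/
lemma ConvexOn.integral_le_integral_map_add_prod {μ ν : Measure E} [IsProbabilityMeasure μ]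
    [IsProbabilityMeasure ν] (hν : Integrable (fun y => y) ν) (hν0 : ∫ y, y ∂ν = 0) {f : E → ℝ}
    (hf : ConvexOn ℝ Set.univ f) (hfμ : Integrable f μ)
    (hfμν : Integrable f ((μ.prod ν).map fun p => p.1 + p.2)) :
    ∫ x, f x ∂μ ≤ ∫ x, f x ∂((μ.prod ν).map fun p => p.1 + p.2) := by
  have hcont : Continuous f := continuousOn_univ.1 (hf.continuousOn isOpen_univ)
  have := FiniteDimensional.complete ℝ E
  have hadd : AEMeasurable (fun p : E × E => p.1 + p.2) (μ.prod ν) := by fun_prop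
  rw [integrable_map_measure hcont.aestronglyMeasurable hadd, Function.comp_def] at hfμν
  rw [integral_map hadd hcont.aestronglyMeasurable, integral_prod _ hfμν]
  refine integral_mono_ae hfμ hfμν.integral_prod_left ?_
  filter_upwards [hfμν.prod_right_ae] with x hx
  have hint : Integrable (fun y => x + y) ν := (integrable_const x).add hν
  have hmean : ∫ y, (x + y) ∂ν = x := by
    rw [integral_add (integrable_const x) hν, hν0]
    simp
  calc f x = f (∫ y, (x + y) ∂ν) := by rw [hmean]
    _ ≤ ∫ y, f (x + y) ∂ν :=
      hf.map_integral_le hcont.continuousOn isClosed_univ (.of_forall fun _ => Set.mem_univ _)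
        hint hx

end

/-- Lemma on the one-step Euler kernel, part (iii): for fixed `x`, the function
`u ↦ ∫ φ(x + h B(x) + √h u z + c) γ_q(dz)` is non-decreasing w.r.t. the matrix order `⪯`. -/
theorem euler_kernel_monotone_in_matrix_order
    {d q : ℕ} (hd : 1 ≤ d) (hq : 1 ≤ q) (h : ℝ) (hh : 0 < h)
    (c : EuclideanSpace ℝ (Fin d))
    (B : EuclideanSpace ℝ (Fin d) → EuclideanSpace ℝ (Fin d))
    (hB : ∀ x y : EuclideanSpace ℝ (Fin d), ∀ t : ℝ,
      B (t • x + (1 - t) • y) = t • B x + (1 - t) • B y)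
    (φ : EuclideanSpace ℝ (Fin d) → ℝ)
    (hφconv : ConvexOn ℝ Set.univ φ)
    (hφgrowth : ∃ C > 0, ∀ x, |φ x| ≤ C * (1 + ‖x‖)) :
    ∀ (x : EuclideanSpace ℝ (Fin d)) (u v : Matrix (Fin d) (Fin q) ℝ), matLE u v →
      ∫ z, φ (x + h • B x + Real.sqrt h • matVec u z + c) ∂(stdGaussian q) ≤
        ∫ z, φ (x + h • B x + Real.sqrt h • matVec v z + c) ∂(stdGaussian q) := by
  intro x u v huv
  obtain ⟨C, hC, hgrowth⟩ := hφgrowth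
  set a := x + h • B x
  set f : EuclideanSpace ℝ (Fin d) → ℝ := fun y => φ (a + Real.sqrt h • y + c)
  have hfconv : ConvexOn ℝ Set.univ f := by
    refine ⟨convex_univ, fun y _ z _ s t hs ht hst => ?_⟩
    have hcomb : a + Real.sqrt h • (s • y + t • z) + c =
        s • (a + Real.sqrt h • y + c) + t • (a + Real.sqrt h • z + c) := by
      obtain rfl : s = 1 - t := by linarith
      module
    simpa only [f, hcomb] using hφconv.2 (Set.mem_univ _) (Set.mem_univ _) hs ht hst
  have hfcont : Continuous f := continuousOn_univ.1 (hfconv.continuousOn isOpen_univ)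
  have hfgrowth : ∀ y, |f y| ≤ C * (1 + ‖a‖ + ‖c‖ + Real.sqrt h) * (1 + ‖y‖) := by
    intro y
    have hnorm : ‖a + Real.sqrt h • y + c‖ ≤ ‖a‖ + Real.sqrt h * ‖y‖ + ‖c‖ := by
      refine norm_add₃_le.trans_eq ?_
      rw [norm_smul, Real.norm_of_nonneg (Real.sqrt_nonneg h)]
    have hle : 1 + ‖a + Real.sqrt h • y + c‖ ≤
        (1 + ‖a‖ + ‖c‖ + Real.sqrt h) * (1 + ‖y‖) := by
      have h1 : 0 ≤ (1 + ‖a‖ + ‖c‖) * ‖y‖ := by positivity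
      linarith [Real.sqrt_nonneg h]
    calc |f y| ≤ C * (1 + ‖a + Real.sqrt h • y + c‖) := hgrowth _
      _ ≤ C * ((1 + ‖a‖ + ‖c‖ + Real.sqrt h) * (1 + ‖y‖)) := by gcongr
      _ = _ := by ring
  have hint (w : Matrix (Fin d) (Fin q) ℝ) :
      Integrable f ((_root_.stdGaussian q).map (matVec w)) :=
    integrable_of_linear_growth IsGaussian.integrable_fun_id hfcont hfgrowth
  have hmap (w : Matrix (Fin d) (Fin q) ℝ) :
      ∫ z, f (matVec w z) ∂(_root_.stdGaussian q) =
        ∫ y, f y ∂((_root_.stdGaussian q).map (matVec w)) :=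
    (integral_map (by rw [matVec_eq_toEuclideanLin]; fun_prop)
      hfcont.aestronglyMeasurable).symm
  have hsum : (_root_.stdGaussian q).map (matVec v) =
      (((_root_.stdGaussian q).map (matVec u)).prod
        (multivariateGaussian 0 (v * v.transpose - u * u.transpose))).map
          (fun p => p.1 + p.2) := by
    have hS : (u * u.transpose).PosSemidef := by
      simpa using Matrix.posSemidef_self_mul_conjTranspose u
    rw [map_matVec_eq_multivariateGaussian, map_matVec_eq_multivariateGaussian,
      map_add_prod_multivariateGaussian hS huv, add_sub_cancel]
  change ∫ z, f (matVec u z) ∂(_root_.stdGaussian q) ≤ ∫ z, f (matVec v z) ∂(_root_.stdGaussian q)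
  rw [hmap, hmap, hsum]
  exact hfconv.integral_le_integral_map_add_prod IsGaussian.integrable_fun_id
    integral_id_multivariateGaussian (hint u) (hsum ▸ hint v)

end
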